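/- Let d, k ≥ 1, σ > 2, let ψ be a σ-truncation function on ℝ^k, and let c4, C ≥ 0. Let A ⊆ ℝ^d be a bounded open set and suppose that to every measurable u : ℝ^d → ℝ^k there is associated a finite Borel measure μ_u on A such that: (lsc) for every open U ⊆ A and every sequence u_n → u in measure on A, μ_u(U) ≤ liminf_n μ_{u_n}(U); (trunc) for every open U ⊆ A, every measurable u, every R > 0 and every integer m ≥ 1, (1/m)·Σ_{i=1}^m μ_{ψ_R^i ∘ u}(U) ≤ μ_u(U) + c4·L^d(U ∩ {|u| ≥ R}) + (C/m)·(μ_u(U) + L^d(U)). Let u be measurable and assume there is a finite Borel measure λ on A such that μ_u ≤ λ and μ_{ψ_R^i ∘ u} ≤ λ for every R > 0 and every integer i ≥ 1. Then for every sequence of positive reals R_m → +∞ and every Borel set B ⊆ A: (a) (1/m)·Σ_{i=1}^m μ_{ψ_{R_m}^i ∘ u}(B) → μ_u(B) as m → +∞; (b) the same convergence holds with each measure replaced by its absolutely continuous part with respect to Lebesgue measure; (c) the same convergence holds with each measure replaced by its singular part with respect to Lebesgue measure. -/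

import Mathlib

open Filter MeasureTheory
open scoped Topology ENNReal

/-- A `σ`-truncation function on `ℝ^k`. -/
def IsTruncation {k : ℕ} (σ : ℝ)
    (ψ : EuclideanSpace ℝ (Fin k) → EuclideanSpace ℝ (Fin k)) : Prop :=
  ContDiff ℝ (⊤ : ℕ∞) ψ ∧ HasCompactSupport ψ ∧
    (∀ y, ‖y‖ ≤ 1 → ψ y = y) ∧ (∀ y, σ ≤ ‖y‖ → ψ y = 0) ∧
    (∀ y, ‖ψ y‖ ≤ σ) ∧ (∀ y z, ‖ψ y - ψ z‖ ≤ ‖y - z‖)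

/-- The rescaled truncation `ψ_R(y) := R · ψ(y/R)`. -/
noncomputable def psiR {k : ℕ} (ψ : EuclideanSpace ℝ (Fin k) → EuclideanSpace ℝ (Fin k))
    (R : ℝ) (y : EuclideanSpace ℝ (Fin k)) : EuclideanSpace ℝ (Fin k) :=
  R • ψ (R⁻¹ • y)

/-- Convergence in measure on a set `A ⊆ ℝ^d`. -/
def ConvInMeasure {d k : ℕ} (A : Set (EuclideanSpace ℝ (Fin d)))
    (un : ℕ → EuclideanSpace ℝ (Fin d) → EuclideanSpace ℝ (Fin k))
    (u : EuclideanSpace ℝ (Fin d) → EuclideanSpace ℝ (Fin k)) : Prop :=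
  ∀ η : ℝ, 0 < η →
    Tendsto (fun n => volume {x ∈ A | η < ‖un n x - u x‖}) atTop (𝓝 (0 : ℝ≥0∞))

/-- If `ν m ≤ lam` with `lam` finite, convergence on the open subsets of an open set `A` implies
convergence on all its Borel subsets. -/
theorem tendsto_measure_of_tendsto_isOpen {α : Type*} [TopologicalSpace α] [MeasurableSpace α]
    [OpensMeasurableSpace α] {lam ν₀ : Measure α} [IsFiniteMeasure lam] [lam.OuterRegular]
    {ν : ℕ → Measure α} (hν₀ : ν₀ ≤ lam) (hν : ∀ m, ν m ≤ lam) {A : Set α} (hA : IsOpen A)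
    (h : ∀ U, IsOpen U → U ⊆ A → Tendsto (fun m => ν m U) atTop (𝓝 (ν₀ U)))
    {B : Set α} (hB : MeasurableSet B) (hBA : B ⊆ A) :
    Tendsto (fun m => ν m B) atTop (𝓝 (ν₀ B)) := by
  have hfin : ∀ s, ν₀ s ≠ ∞ := fun s => ne_top_of_le_ne_top (measure_ne_top lam s) (hν₀ s)
  rw [ENNReal.tendsto_nhds (hfin B)]
  intro ε hε
  obtain ⟨V, hBV, hV, -, hVB⟩ :=
    hB.exists_isOpen_sdiff_lt (measure_ne_top lam B) (ENNReal.half_pos hε.ne').ne'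
  have hBU : B ⊆ V ∩ A := Set.subset_inter hBV hBA
  have hdiff : ∀ ρ ≤ lam, ρ (V ∩ A) ≤ ρ B + ε / 2 := fun ρ hρ => calc
    ρ (V ∩ A) ≤ ρ (B ∪ V \ B) := measure_mono fun x hx => by
      by_cases hxB : x ∈ B
      · exact Or.inl hxB
      · exact Or.inr ⟨hx.1, hxB⟩
    _ ≤ ρ B + ρ (V \ B) := measure_union_le _ _
    _ ≤ ρ B + ε / 2 := by gcongr; exact (hρ _).trans hVB.le
  filter_upwards [(ENNReal.tendsto_nhds (hfin _)).1
    (h (V ∩ A) (hV.inter hA) Set.inter_subset_right) (ε / 2) (ENNReal.half_pos hε.ne')] with m hm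
  constructor
  · rw [tsub_le_iff_right]
    calc ν₀ B ≤ ν₀ (V ∩ A) := measure_mono hBU
      _ ≤ ν m (V ∩ A) + ε / 2 := tsub_le_iff_right.1 hm.1
      _ ≤ ν m B + ε / 2 + ε / 2 := by gcongr; exact hdiff _ (hν m)
      _ = ν m B + ε := by rw [add_assoc, ENNReal.add_halves]
  · calc ν m B ≤ ν m (V ∩ A) := measure_mono hBU
      _ ≤ ν₀ (V ∩ A) + ε / 2 := hm.2
      _ ≤ ν₀ B + ε / 2 + ε / 2 := by gcongr; exact hdiff _ hν₀
      _ = ν₀ B + ε := by rw [add_assoc, ENNReal.add_halves]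

/-- The Lebesgue decompositions of all measures dominated by a finite measure `lam` are obtained
by restricting to a single set and to its complement. -/
theorem exists_set_lebesgueDecomposition_of_le {α : Type*} [MeasurableSpace α]
    (lam vol : Measure α) [IsFiniteMeasure lam] [SigmaFinite vol] :
    ∃ S, MeasurableSet S ∧ ∀ ν ≤ lam, ∀ B,
      ν.singularPart vol B = ν (B ∩ S) ∧
      vol.withDensity (ν.rnDeriv vol) B = ν (B ∩ Sᶜ) := by
  obtain ⟨T, hT, hT₁, hT₂⟩ := lam.mutuallySingular_singularPart vol
  refine ⟨Tᶜ, hT.compl, fun ν hν B => ?_⟩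
  rw [compl_compl]
  have : IsFiniteMeasure ν := isFiniteMeasure_of_le lam hν
  have hac : ν.restrict T ≪ vol := by
    have hle : lam.restrict T ≪ vol := by
      rw [lam.haveLebesgueDecomposition_add vol, Measure.restrict_add,
        Measure.restrict_eq_zero.2 hT₁, zero_add]
      exact Measure.restrict_le_self.absolutelyContinuous.trans
        (withDensity_absolutelyContinuous _ _)
    exact (Measure.restrict_mono le_rfl hν).absolutelyContinuous.trans hle
  have hsing : ν.singularPart vol T = 0 := by
    have hle : (ν.singularPart vol).restrict T ≪ vol :=
      (Measure.restrict_mono le_rfl (ν.singularPart_le vol)).absolutelyContinuous.trans hac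
    have hms : (ν.singularPart vol).restrict T ⟂ₘ vol :=
      (ν.mutuallySingular_singularPart vol).mono_ac
        Measure.restrict_le_self.absolutelyContinuous .rfl
    exact Measure.restrict_eq_zero.1 (Measure.eq_zero_of_absolutelyContinuous_of_mutuallySingular
      hle hms)
  have hwd : vol.withDensity (ν.rnDeriv vol) Tᶜ = 0 := withDensity_absolutelyContinuous _ _ hT₂
  have hadd : ∀ s, ν s = ν.singularPart vol s + vol.withDensity (ν.rnDeriv vol) s := fun s => by
    conv_lhs => rw [ν.haveLebesgueDecomposition_add vol]
    rfl
  constructor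
  · rw [hadd, measure_mono_null Set.inter_subset_right hwd, add_zero]
    conv_lhs => rw [← measure_inter_add_sdiff B hT, measure_mono_null Set.inter_subset_right hsing,
      zero_add, Set.sdiff_eq]
  · rw [hadd, measure_mono_null Set.inter_subset_right hsing, zero_add]
    conv_lhs => rw [← measure_inter_add_sdiff B hT, Set.sdiff_eq,
      measure_mono_null Set.inter_subset_right hwd, add_zero]

theorem inv_smul_sum_range_le {α : Type*} [MeasurableSpace α] {lam : Measure α}
    {ν : ℕ → Measure α} (h : ∀ i, ν i ≤ lam) (m : ℕ) :
    (m : ℝ≥0∞)⁻¹ • ∑ i ∈ Finset.range m, ν i ≤ lam := by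
  refine Measure.le_iff'.2 fun s => ?_
  rw [Measure.smul_apply, Measure.finsetSum_apply, smul_eq_mul]
  calc (m : ℝ≥0∞)⁻¹ * ∑ i ∈ Finset.range m, ν i s
      ≤ (m : ℝ≥0∞)⁻¹ * ∑ _i ∈ Finset.range m, lam s := by
        gcongr with i; exact h i
    _ = ((m : ℝ≥0∞)⁻¹ * m) * lam s := by simp [mul_assoc]
    _ ≤ 1 * lam s := by gcongr; exact ENNReal.inv_mul_le_one _
    _ = lam s := one_mul _

theorem exists_le_inv_mul_sum_range (a : ℕ → ℝ≥0∞) {m : ℕ} (hm : m ≠ 0) :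
    ∃ i, a i ≤ (m : ℝ≥0∞)⁻¹ * ∑ j ∈ Finset.range m, a j := by
  obtain ⟨i, -, hi⟩ := (Finset.range m).exists_min_image a (by simpa using hm)
  refine ⟨i, ?_⟩
  calc a i = (m : ℝ≥0∞)⁻¹ * ∑ _j ∈ Finset.range m, a i := by
        simp [← mul_assoc, ENNReal.inv_mul_cancel, hm]
    _ ≤ _ := by gcongr with j hj; exact hi j hj

theorem tendsto_measure_inter_le_norm {α E : Type*} [MeasurableSpace α] [NormedAddCommGroup E]
    [MeasurableSpace E] [OpensMeasurableSpace E] {vol : Measure α} {A : Set α}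
    (hA : MeasurableSet A) (hAfin : vol A ≠ ∞) {u : α → E} (hu : Measurable u) :
    Tendsto (fun R : ℝ => vol (A ∩ {x | R ≤ ‖u x‖})) atTop (𝓝 0) := by
  have hempty : ⋂ R : ℝ, A ∩ {x | R ≤ ‖u x‖} = ∅ := by
    refine Set.eq_empty_of_forall_notMem fun x hx => ?_
    have := (Set.mem_iInter.1 hx (‖u x‖ + 1)).2
    simp only [Set.mem_ofPred_eq] at this
    linarith
  rw [← measure_empty (μ := vol), ← hempty]
  refine tendsto_measure_iInter_atTop
    (fun R => (hA.inter (measurableSet_le measurable_const hu.norm)).nullMeasurableSet)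
    (fun R R' hR x hx => ⟨hx.1, hR.trans hx.2⟩)
    ⟨0, measure_ne_top_of_subset Set.inter_subset_left hAfin⟩

theorem IsTruncation.psiR_eq_self {k : ℕ} {σ : ℝ}
    {ψ : EuclideanSpace ℝ (Fin k) → EuclideanSpace ℝ (Fin k)} (hψ : IsTruncation σ ψ)
    {R : ℝ} (hR : 0 < R) {y : EuclideanSpace ℝ (Fin k)} (hy : ‖y‖ ≤ R) : psiR ψ R y = y := by
  have h : ‖R⁻¹ • y‖ ≤ 1 := by
    rw [norm_smul, norm_inv, Real.norm_of_nonneg hR.le, inv_mul_le_one₀ hR]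
    exact hy
  rw [psiR, hψ.2.2.1 _ h, smul_inv_smul₀ hR.ne']

theorem IsTruncation.measurable_psiR {k : ℕ} {σ : ℝ}
    {ψ : EuclideanSpace ℝ (Fin k) → EuclideanSpace ℝ (Fin k)} (hψ : IsTruncation σ ψ) (R : ℝ) :
    Measurable (psiR ψ R) := by
  have := hψ.1.continuous
  unfold psiR
  exact Continuous.measurable (by fun_prop)

/-- Truncating `u` at levels that tend to infinity gives convergence in measure to `u`. -/
theorem IsTruncation.convInMeasure {d k : ℕ} {σ : ℝ}
    {ψ : EuclideanSpace ℝ (Fin k) → EuclideanSpace ℝ (Fin k)} (hψ : IsTruncation σ ψ)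
    {A : Set (EuclideanSpace ℝ (Fin d))} (hA : MeasurableSet A) (hAfin : volume A ≠ ∞)
    {u : EuclideanSpace ℝ (Fin d) → EuclideanSpace ℝ (Fin k)} (hu : Measurable u)
    {R : ℕ → ℝ} (hRpos : ∀ m, 0 < R m) (hR : Tendsto R atTop atTop) :
    ConvInMeasure A (fun m => psiR ψ (R m) ∘ u) u := by
  intro η hη
  refine tendsto_of_tendsto_of_tendsto_of_le_of_le tendsto_const_nhds
    ((tendsto_measure_inter_le_norm hA hAfin hu).comp hR) (fun _ => zero_le) fun m => ?_
  refine measure_mono fun x hx => ⟨hx.1, ?_⟩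
  by_contra hlt
  have hx₂ := hx.2
  simp only [Function.comp_apply] at hx₂
  rw [hψ.psiR_eq_self (hRpos m) (not_le.1 hlt).le, sub_self, norm_zero] at hx₂
  exact hx₂.not_gt hη

/-- convergence of the averaged truncated measures `μ_{ψ_{R_m}^i ∘ u}`
towards `μ_u` on every Borel subset of `A`, together with the same convergence for the
absolutely continuous and singular parts with respect to Lebesgue measure. -/
theorem truncation_measure_convergence (d k : ℕ) (hd : 1 ≤ d) (hk : 1 ≤ k)
    (σ : ℝ) (hσ : 2 < σ)
    (ψ : EuclideanSpace ℝ (Fin k) → EuclideanSpace ℝ (Fin k)) (hψ : IsTruncation σ ψ)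
    (c4 C : ℝ) (hc4 : 0 ≤ c4) (hC : 0 ≤ C)
    (A : Set (EuclideanSpace ℝ (Fin d))) (hAopen : IsOpen A) (hAbdd : Bornology.IsBounded A)
    (μ : (EuclideanSpace ℝ (Fin d) → EuclideanSpace ℝ (Fin k)) →
      Measure (EuclideanSpace ℝ (Fin d)))
    (hfin : ∀ v, IsFiniteMeasure (μ v))
    -- lower semicontinuity on open subsets of `A`
    (hlsc : ∀ U : Set (EuclideanSpace ℝ (Fin d)), IsOpen U → U ⊆ A →
      ∀ v, Measurable v →
      ∀ vn : ℕ → EuclideanSpace ℝ (Fin d) → EuclideanSpace ℝ (Fin k),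
        (∀ n, Measurable (vn n)) → ConvInMeasure A vn v →
        μ v U ≤ liminf (fun n => μ (vn n) U) atTop)
    -- the averaged truncation estimate on open subsets of `A`
    (htrunc : ∀ U : Set (EuclideanSpace ℝ (Fin d)), IsOpen U → U ⊆ A →
      ∀ v, Measurable v → ∀ R : ℝ, 0 < R → ∀ m : ℕ, 1 ≤ m →
      (m : ℝ≥0∞)⁻¹ * ∑ i ∈ Finset.range m, μ (psiR ψ (σ ^ i * R) ∘ v) U ≤
        μ v U + ENNReal.ofReal c4 * volume (U ∩ {x | R ≤ ‖v x‖})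
          + (ENNReal.ofReal C / (m : ℝ≥0∞)) * (μ v U + volume U))
    (u : EuclideanSpace ℝ (Fin d) → EuclideanSpace ℝ (Fin k)) (hu : Measurable u)
    (lam : Measure (EuclideanSpace ℝ (Fin d))) (hlam : IsFiniteMeasure lam)
    (hdom : μ u ≤ lam)
    (hdom' : ∀ R : ℝ, 0 < R → ∀ i : ℕ, μ (psiR ψ (σ ^ i * R) ∘ u) ≤ lam)
    (Rm : ℕ → ℝ) (hRmpos : ∀ m, 0 < Rm m) (hRmtop : Tendsto Rm atTop atTop)
    (B : Set (EuclideanSpace ℝ (Fin d))) (hB : MeasurableSet B) (hBA : B ⊆ A) :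
    -- (a) convergence of the measures
    Tendsto (fun m : ℕ =>
        (m : ℝ≥0∞)⁻¹ * ∑ i ∈ Finset.range m, μ (psiR ψ (σ ^ i * Rm m) ∘ u) B)
      atTop (𝓝 (μ u B)) ∧
    -- (b) convergence of the absolutely continuous parts
    Tendsto (fun m : ℕ =>
        (m : ℝ≥0∞)⁻¹ * ∑ i ∈ Finset.range m,
          (volume.withDensity ((μ (psiR ψ (σ ^ i * Rm m) ∘ u)).rnDeriv volume)) B)
      atTop (𝓝 ((volume.withDensity ((μ u).rnDeriv volume)) B)) ∧
    -- (c) convergence of the singular parts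
    Tendsto (fun m : ℕ =>
        (m : ℝ≥0∞)⁻¹ * ∑ i ∈ Finset.range m,
          ((μ (psiR ψ (σ ^ i * Rm m) ∘ u)).singularPart volume) B)
      atTop (𝓝 (((μ u).singularPart volume) B)) := by
  have hAfin : volume A ≠ ∞ := hAbdd.measure_lt_top.ne
  let ν : ℕ → ℕ → Measure (EuclideanSpace ℝ (Fin d)) :=
    fun m i => μ (psiR ψ (σ ^ i * Rm m) ∘ u)
  have hνlam : ∀ m i, ν m i ≤ lam := fun m i => hdom' _ (hRmpos m) i
  have hRσ : ∀ i m, Rm m ≤ σ ^ i * Rm m := fun i m =>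
    le_mul_of_one_le_left (hRmpos m).le (one_le_pow₀ (by linarith))
  have hopen : ∀ U, IsOpen U → U ⊆ A →
      Tendsto (fun m : ℕ => (m : ℝ≥0∞)⁻¹ * ∑ i ∈ Finset.range m, ν m i U) atTop
        (𝓝 (μ u U)) := by
    intro U hU hUA
    have hUfin : volume U ≠ ∞ := measure_ne_top_of_subset hUA hAfin
    refine tendsto_of_le_liminf_of_limsup_le ?_ ?_
    · have hmin : ∀ m : ℕ, ∃ i, m ≠ 0 →
          ν m i U ≤ (m : ℝ≥0∞)⁻¹ * ∑ j ∈ Finset.range m, ν m j U := fun m => by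
        rcases eq_or_ne m 0 with rfl | hm
        · exact ⟨0, fun h => (h rfl).elim⟩
        · obtain ⟨i, hi⟩ := exists_le_inv_mul_sum_range (fun j => ν m j U) hm
          exact ⟨i, fun _ => hi⟩
      choose i hi using hmin
      refine (hlsc U hU hUA u hu _ (fun m => (hψ.measurable_psiR _).comp hu)
        (hψ.convInMeasure hAopen.measurableSet hAfin hu
          (fun m => (hRmpos m).trans_le (hRσ (i m) m))
          (tendsto_atTop_mono (fun m => hRσ (i m) m) hRmtop))).trans ?_
      refine liminf_le_liminf ?_
      filter_upwards [eventually_ne_atTop 0] with m hm using hi m hm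
    · have hlim : Tendsto (fun m : ℕ => μ u U
          + ENNReal.ofReal c4 * volume (U ∩ {x | Rm m ≤ ‖u x‖})
          + (ENNReal.ofReal C / (m : ℝ≥0∞)) * (μ u U + volume U)) atTop (𝓝 (μ u U)) := by
        have h₁ := ENNReal.Tendsto.const_mul (a := ENNReal.ofReal c4)
          ((tendsto_measure_inter_le_norm hU.measurableSet hUfin hu).comp hRmtop)
          (Or.inr ENNReal.ofReal_ne_top)
        have h₂ := ENNReal.Tendsto.mul_const (b := μ u U + volume U)
          (ENNReal.Tendsto.const_div (a := ENNReal.ofReal C) ENNReal.tendsto_nat_nhds_top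
            (Or.inr ENNReal.ofReal_ne_top))
          (Or.inr (ENNReal.add_ne_top.2 ⟨measure_ne_top_of_subset (Set.subset_univ _)
            (hfin u).measure_univ_lt_top.ne, hUfin⟩))
        simpa using (tendsto_const_nhds.add h₁).add h₂
      rw [← hlim.limsup_eq]
      refine limsup_le_limsup ?_
      filter_upwards [eventually_ge_atTop 1] with m hm
      exact htrunc U hU hUA u hu (Rm m) (hRmpos m) m hm
  have hBorel : ∀ B, MeasurableSet B → B ⊆ A →
      Tendsto (fun m : ℕ => (m : ℝ≥0∞)⁻¹ * ∑ i ∈ Finset.range m, ν m i B) atTop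
        (𝓝 (μ u B)) := by
    intro B hB hBA
    have := tendsto_measure_of_tendsto_isOpen
      (ν := fun m : ℕ => (m : ℝ≥0∞)⁻¹ • ∑ i ∈ Finset.range m, ν m i) hdom
      (fun m => inv_smul_sum_range_le (hνlam m) m) hAopen
      (by simpa [Measure.finsetSum_apply] using hopen) hB hBA
    simpa [Measure.finsetSum_apply] using this
  obtain ⟨S, hS, hdec⟩ := exists_set_lebesgueDecomposition_of_le lam
    (volume : Measure (EuclideanSpace ℝ (Fin d)))
  refine ⟨hBorel B hB hBA, ?_, ?_⟩
  · simp_rw [fun m i => (hdec _ (hdom' (Rm m) (hRmpos m) i) B).2, (hdec _ hdom B).2]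
    exact hBorel _ (hB.inter hS.compl) (Set.inter_subset_left.trans hBA)
  · simp_rw [fun m i => (hdec _ (hdom' (Rm m) (hRmpos m) i) B).1, (hdec _ hdom B).1]
    exact hBorel _ (hB.inter hS) (Set.inter_subset_left.trans hBA)
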